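/- arXiv:2409.07066 — 2 statements merged into one kernel-verified Lean document; each statement's English description precedes it below -/
import Mathlib

section
/- Let d ≥ 1 and let f : ℝ^d → ℝ^d be a continuously differentiable map such that for every x ∈ ℝ^d the Fréchet derivative Df(x) is an invertible linear map, and suppose there is a constant C > 0 with ‖Df(x)^{-1}‖ ≤ C for all x ∈ ℝ^d (operator norm of the inverse). Then f is bijective. -/
open Set Filter Topology unitInterval

section HadamardLevy

variable {E F : Type*} [NormedAddCommGroup E] [NormedSpace ℝ E]
  [NormedAddCommGroup F] [NormedSpace ℝ F] {f : E → F}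

/-- A continuous lift of the segment `t ↦ y + t • v` through a local homeomorphism whose derivative
has inverse bounded by `C` stays within `C * ‖v‖ * t` of its starting point. -/
theorem IsLocalHomeomorph.norm_lift_segment_sub_le (hf : IsLocalHomeomorph f)
    {f' : E → E ≃L[ℝ] F} (hf' : ∀ x, HasFDerivAt f (f' x : E →L[ℝ] F) x)
    {C : ℝ} (hC : ∀ x, ‖((f' x).symm : F →L[ℝ] E)‖ ≤ C) {y v : F} {Γ : ℝ → E} {T : ℝ}
    (hΓ : ContinuousOn Γ (Icc 0 T)) (hlift : ∀ t ∈ Icc 0 T, f (Γ t) = y + t • v) :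
    ∀ t ∈ Icc 0 T, ‖Γ t - Γ 0‖ ≤ C * ‖v‖ * (t - 0) := by
  refine norm_image_sub_le_of_norm_deriv_right_le_segment
    (f' := fun t ↦ (f' (Γ t)).symm v) hΓ (fun t ht ↦ ?_) (fun t _ ↦ ?_)
  · obtain ⟨e, hmem, rfl⟩ := hf (Γ t)
    have htI : t ∈ Icc 0 T := ⟨ht.1, ht.2.le⟩
    have hbase : e.symm (y + t • v) = Γ t := by rw [← hlift t htI, e.left_inv hmem]
    have hsymm : HasFDerivAt e.symm ((f' (Γ t)).symm : F →L[ℝ] E) (y + t • v) := by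
      refine e.hasFDerivAt_symm (hlift t htI ▸ e.map_source hmem) ?_
      rw [hbase]
      exact hf' _
    have hline : HasDerivAt (fun s : ℝ ↦ y + s • v) v t := by
      simpa using ((hasDerivAt_id t).smul_const v).const_add y
    refine (hsymm.comp_hasDerivAt t hline).hasDerivWithinAt.congr_of_eventuallyEq ?_ hbase.symm
    have hnhds : Icc 0 T ∈ 𝓝[Ici t] t :=
      mem_of_superset (Icc_mem_nhdsGE ht.2) (Icc_subset_Icc_left ht.1)
    have hcont : Tendsto Γ (𝓝[Ici t] t) (𝓝 (Γ t)) :=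
      (hΓ t htI).mono_left (nhdsWithin_le_of_mem hnhds)
    filter_upwards [hnhds, hcont (e.open_source.mem_nhds hmem)] with s hs hse
    rw [Function.comp_apply, ← hlift s hs]
    exact (e.left_inv hse).symm
  · exact ((f' (Γ t)).symm : F →L[ℝ] E).le_of_opNorm_le (hC _) v

/-- A local homeomorphism has local sections on balls of uniform radius over a compact set. -/
theorem IsLocalHomeomorph.exists_uniform_section {X Y : Type*} [TopologicalSpace X]
    [PseudoMetricSpace Y] {f : X → Y} (hf : IsLocalHomeomorph f) {K : Set X} (hK : IsCompact K) :
    ∃ δ > 0, ∀ x ∈ K, ∃ s : Y → X, ContinuousOn s (Metric.ball (f x) δ) ∧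
      (∀ y ∈ Metric.ball (f x) δ, f (s y) = y) ∧ s (f x) = x := by
  refine hK.induction_on ?_ (fun s t hst ht ↦ ?_) (fun s t hs ht ↦ ?_) fun z _ ↦ ?_
  · exact ⟨1, one_pos, by simp⟩
  · obtain ⟨δ, hδ, h⟩ := ht
    exact ⟨δ, hδ, fun x hx ↦ h x (hst hx)⟩
  · obtain ⟨δ, hδ, h⟩ := hs
    obtain ⟨ε, hε, h'⟩ := ht
    refine ⟨min δ ε, lt_min hδ hε, fun x hx ↦ ?_⟩
    obtain ⟨r, hr, g, hg, hg_f, hg_x⟩ : ∃ r, min δ ε ≤ r ∧ ∃ g : Y → X,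
        ContinuousOn g (Metric.ball (f x) r) ∧
        (∀ y ∈ Metric.ball (f x) r, f (g y) = y) ∧ g (f x) = x :=
      hx.elim (fun hx ↦ ⟨δ, min_le_left _ _, h x hx⟩) fun hx ↦ ⟨ε, min_le_right _ _, h' x hx⟩
    have hsub := Metric.ball_subset_ball (x := f x) hr
    exact ⟨g, hg.mono hsub, fun y hy ↦ hg_f y (hsub hy), hg_x⟩
  · obtain ⟨e, hmem, rfl⟩ := hf z
    obtain ⟨ε, hε, hball⟩ := Metric.isOpen_iff.1 e.open_target _ (e.map_source hmem)
    have hU : e.source ∩ e ⁻¹' Metric.ball (e z) (ε / 2) ∈ 𝓝 z :=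
      inter_mem (e.open_source.mem_nhds hmem)
        ((e.continuousAt hmem).preimage_mem_nhds (Metric.ball_mem_nhds _ (half_pos hε)))
    refine ⟨_, mem_nhdsWithin_of_mem_nhds hU, ε / 2, half_pos hε, fun x hx ↦ ?_⟩
    have hsub : Metric.ball (e x) (ε / 2) ⊆ e.target := by
      refine (Metric.ball_subset_ball' ?_).trans hball
      have := Metric.mem_ball.1 hx.2
      linarith
    exact ⟨e.symm, e.continuousOn_symm.mono hsub, fun y hy ↦ e.right_inv (hsub hy),
      e.left_inv hx.1⟩

/-- Segments lift through a local homeomorphism whose derivative has uniformly bounded inverse. -/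
theorem IsLocalHomeomorph.exists_lift_segment [ProperSpace E] (hf : IsLocalHomeomorph f)
    {f' : E → E ≃L[ℝ] F} (hf' : ∀ x, HasFDerivAt f (f' x : E →L[ℝ] F) x)
    {C : ℝ} (hC : ∀ x, ‖((f' x).symm : F →L[ℝ] E)‖ ≤ C) (x : E) (v : F) :
    ∃ Γ : ℝ → E, ContinuousOn Γ (Icc 0 1) ∧ (∀ t ∈ Icc (0 : ℝ) 1, f (Γ t) = f x + t • v) ∧
      Γ 0 = x := by
  have hC0 : 0 ≤ C := (norm_nonneg _).trans (hC x)
  obtain ⟨δ, hδ, hsec⟩ := hf.exists_uniform_section (isCompact_closedBall x (C * ‖v‖))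
  obtain ⟨N, hN⟩ := exists_nat_gt (‖v‖ / δ)
  have hN0 : (0 : ℝ) < N := (by positivity : 0 ≤ ‖v‖ / δ).trans_lt hN
  suffices H : ∀ n : ℕ, n ≤ N → ∃ Γ : ℝ → E, ContinuousOn Γ (Icc 0 (n / N : ℝ)) ∧
      (∀ t ∈ Icc (0 : ℝ) (n / N), f (Γ t) = f x + t • v) ∧ Γ 0 = x by
    simpa [div_self hN0.ne'] using H N le_rfl
  intro n
  induction n with
  | zero => exact fun _ ↦ ⟨fun _ ↦ x, continuousOn_const, by simp, rfl⟩
  | succ n ih =>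
    intro hn
    obtain ⟨Γ, hΓ, hlift, hΓ0⟩ := ih (Nat.le_of_succ_le hn)
    set a : ℝ := n / N with ha
    set b : ℝ := (n + 1 : ℕ) / N with hb
    have ha0 : 0 ≤ a := by positivity
    have hab : b - a = 1 / N := by rw [ha, hb]; push_cast; ring
    have hb1 : b ≤ 1 := div_le_one_of_le₀ (by exact_mod_cast hn) hN0.le
    have hab' : a < b := by
      have : 0 < 1 / (N : ℝ) := by positivity
      linarith
    have haI : a ∈ Icc 0 a := ⟨ha0, le_rfl⟩
    have hmem : Γ a ∈ Metric.closedBall x (C * ‖v‖) := by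
      rw [mem_closedBall_iff_norm]
      have h := hf.norm_lift_segment_sub_le hf' hC hΓ hlift a haI
      rw [hΓ0, sub_zero] at h
      exact h.trans (mul_le_of_le_one_right (by positivity) (hab'.le.trans hb1))
    obtain ⟨s, hs, hfs, hsa⟩ := hsec _ hmem
    rw [hlift a haI] at hs hfs hsa
    have hball : ∀ t ∈ Icc a b, f x + t • v ∈ Metric.ball (f x + a • v) δ := by
      intro t ht
      rw [mem_ball_iff_norm, add_sub_add_left_eq_sub, ← sub_smul, norm_smul, Real.norm_eq_abs,
        abs_of_nonneg (sub_nonneg.2 ht.1)]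
      calc (t - a) * ‖v‖ ≤ 1 / N * ‖v‖ := by gcongr; linarith [ht.2]
        _ < δ := by rw [one_div_mul_eq_div]; exact (div_lt_comm₀ hδ hN0).1 hN
    have hglue : EqOn (fun t ↦ if t ≤ a then Γ t else s (f x + t • v))
        (fun t ↦ s (f x + t • v)) (Icc a b) := by
      intro t ht
      rcases ht.1.eq_or_lt with rfl | hlt
      · simp [hsa]
      · simp [hlt.not_ge]
    refine ⟨fun t ↦ if t ≤ a then Γ t else s (f x + t • v), ?_, fun t ht ↦ ?_, by simp [ha0, hΓ0]⟩
    · rw [← Icc_union_Icc_eq_Icc ha0 hab'.le]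
      refine ContinuousOn.union_of_isClosed (hΓ.congr fun t ht ↦ if_pos ht.2) ?_
        isClosed_Icc isClosed_Icc
      exact (hs.comp (by fun_prop) hball).congr hglue
    · rcases le_total t a with hta | hta
      · simpa [hta] using hlift t ⟨ht.1, hta⟩
      · exact (congrArg f (hglue ⟨hta, ht.2⟩)).trans (hfs _ (hball t ⟨hta, ht.2⟩))

/-- **Hadamard–Lévy theorem** for local homeomorphisms. -/
theorem IsLocalHomeomorph.bijective_of_norm_symm_le [ProperSpace E] (hf : IsLocalHomeomorph f)
    {f' : E → E ≃L[ℝ] F} (hf' : ∀ x, HasFDerivAt f (f' x : E →L[ℝ] F) x)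
    {C : ℝ} (hC : ∀ x, ‖((f' x).symm : F →L[ℝ] E)‖ ≤ C) : Function.Bijective f := by
  have hsep : IsSeparatedMap f := T2Space.isSeparatedMap f
  choose Γ hΓ hlift hΓ0 using fun y ↦ hf.exists_lift_segment hf' hC 0 (y - f 0)
  have hcont : Continuous fun p : I × F ↦ Γ p.2 p.1 :=
    hf.continuous_lift hsep ⟨fun p : I × F ↦ f 0 + (p.1 : ℝ) • (p.2 - f 0), by fun_prop⟩
      (funext fun p ↦ hlift p.2 p.1 p.1.2) (by simpa [hΓ0] using continuous_const)
      fun y ↦ continuousOn_iff_continuous_domRestrict.1 (hΓ y)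
  have hright : ∀ y, f (Γ y 1) = y := fun y ↦ by simpa using hlift y 1 (by simp)
  have hbase : Γ (f 0) 1 = 0 := by
    have h := hf.norm_lift_segment_sub_le hf' hC (hΓ (f 0)) (hlift (f 0)) 1 (by simp)
    simpa [hΓ0] using h
  have hleft : (fun x ↦ Γ (f x) 1) = id :=
    hsep.eq_of_comp_eq hf.isLocallyInjective
      (hcont.comp (continuous_const.prodMk hf.continuous : Continuous fun x ↦ ((1 : I), f x)))
      continuous_id (funext fun x ↦ hright (f x)) 0 hbase
  exact ⟨Function.LeftInverse.injective (g := fun y ↦ Γ y 1) (congrFun hleft),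
    Function.RightInverse.surjective (g := fun y ↦ Γ y 1) hright⟩

/-- A `C¹` map with everywhere invertible derivative is a local homeomorphism. -/
theorem ContDiff.isLocalHomeomorph_of_hasFDerivAt_equiv [CompleteSpace E] (hf : ContDiff ℝ 1 f)
    {f' : E → E ≃L[ℝ] F} (hf' : ∀ x, HasFDerivAt f (f' x : E →L[ℝ] F) x) :
    IsLocalHomeomorph f := fun x ↦
  ⟨hf.contDiffAt.toOpenPartialHomeomorph f (hf' x) one_ne_zero,
    hf.contDiffAt.mem_toOpenPartialHomeomorph_source (hf' x) one_ne_zero, rfl⟩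

end HadamardLevy


/-- **Hadamard–Lévy global inverse theorem** as used in the paper:
a `C¹` map `f : ℝ^d → ℝ^d` whose Fréchet derivative is everywhere invertible
with uniformly bounded inverse is bijective. -/
theorem stmt0 (d : ℕ) (hd : 1 ≤ d)
    (f : EuclideanSpace ℝ (Fin d) → EuclideanSpace ℝ (Fin d))
    (f' : EuclideanSpace ℝ (Fin d) → (EuclideanSpace ℝ (Fin d) ≃L[ℝ] EuclideanSpace ℝ (Fin d)))
    (hf : ContDiff ℝ 1 f)
    (hderiv : ∀ x, HasFDerivAt f
      ((f' x : EuclideanSpace ℝ (Fin d) →L[ℝ] EuclideanSpace ℝ (Fin d))) x)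
    (C : ℝ) (hC : 0 < C)
    (hbound : ∀ x, ‖((f' x).symm : EuclideanSpace ℝ (Fin d) →L[ℝ] EuclideanSpace ℝ (Fin d))‖ ≤ C) :
    Function.Bijective f := by
  exact (hf.isLocalHomeomorph_of_hasFDerivAt_equiv hderiv).bijective_of_norm_symm_le hderiv hbound
end

section
/- Let d ≥ 1, p ≥ 2, q > 0 and α, c > 0, and consider the Ogden-type elastic energy W_el(F) = (α/p)‖F‖^p + (c/q)(det F)^{−q}, where ‖·‖ denotes the Frobenius norm on d×d real matrices, defined for F with det F > 0. Then there exists a constant C > 0 (one may take C = max(p, q√d)) such that for every d×d real matrix A with det A > 0, the Kirchhoff-type stress K(A) = α‖A‖^{p−2} A Aᵀ − c (det A)^{−q} I satisfies ‖K(A)‖ ≤ C (1 + W_el(A)). -/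
open Matrix

/-- Frobenius norm of a real `d × d` matrix. -/
noncomputable def fnorm {d : ℕ} (F : Matrix (Fin d) (Fin d) ℝ) : ℝ :=
  Real.sqrt (∑ i, ∑ j, (F i j) ^ 2)

/-- Ogden-type elastic energy `W_el(F) = (α/p)‖F‖^p + (c/q)(det F)^{-q}`. -/
noncomputable def Wel {d : ℕ} (p q α c : ℝ) (F : Matrix (Fin d) (Fin d) ℝ) : ℝ :=
  (α / p) * fnorm F ^ p + (c / q) * F.det ^ (-q)

/-- Kirchhoff-type stress `K(A) = α‖A‖^{p−2} A Aᵀ − c (det A)^{−q} I` of the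
Ogden-type energy. -/
noncomputable def Kstress {d : ℕ} (p q α c : ℝ) (A : Matrix (Fin d) (Fin d) ℝ) :
    Matrix (Fin d) (Fin d) ℝ :=
  (α * fnorm A ^ (p - 2)) • (A * Aᵀ) - (c * A.det ^ (-q)) • (1 : Matrix (Fin d) (Fin d) ℝ)

section Frobenius

attribute [local instance] Matrix.frobeniusNormedRing Matrix.frobeniusNormedSpace

theorem fnorm_eq_norm {d : ℕ} (F : Matrix (Fin d) (Fin d) ℝ) : fnorm F = ‖F‖ := by
  simp [fnorm, Matrix.frobenius_norm_def, Real.sqrt_eq_rpow]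

theorem fnorm_nonneg {d : ℕ} (F : Matrix (Fin d) (Fin d) ℝ) : 0 ≤ fnorm F :=
  Real.sqrt_nonneg _

theorem fnorm_sub_le {d : ℕ} (F G : Matrix (Fin d) (Fin d) ℝ) :
    fnorm (F - G) ≤ fnorm F + fnorm G := by
  simpa only [fnorm_eq_norm] using norm_sub_le F G

theorem fnorm_smul {d : ℕ} (r : ℝ) (F : Matrix (Fin d) (Fin d) ℝ) :
    fnorm (r • F) = |r| * fnorm F := by
  simpa only [fnorm_eq_norm, Real.norm_eq_abs] using norm_smul r F

theorem fnorm_mul_transpose_self_le {d : ℕ} (F : Matrix (Fin d) (Fin d) ℝ) :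
    fnorm (F * Fᵀ) ≤ fnorm F ^ 2 := by
  simpa only [fnorm_eq_norm, Matrix.frobenius_norm_transpose, sq] using
    Matrix.frobenius_norm_mul F Fᵀ

end Frobenius

theorem fnorm_one (d : ℕ) : fnorm (1 : Matrix (Fin d) (Fin d) ℝ) = √d := by
  simp [fnorm, Matrix.one_apply]

/-- Control-of-stress condition (2.2) of assumption (A1) for the Ogden-type
example: `‖K(A)‖ ≤ C (1 + W_el(A))` for some `C > 0`. -/
theorem stmt14 (d : ℕ) (hd : 1 ≤ d) (p q α c : ℝ)
    (hp : 2 ≤ p) (hq : 0 < q) (hα : 0 < α) (hc : 0 < c) :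
    ∃ C > (0 : ℝ), ∀ A : Matrix (Fin d) (Fin d) ℝ, 0 < A.det →
      fnorm (Kstress p q α c A) ≤ C * (1 + Wel p q α c A) := by
  refine ⟨max p (q * √d), lt_max_of_lt_left (by linarith), fun A hA => ?_⟩
  have hp0 : 0 < p := by linarith
  have hdet : 0 ≤ A.det ^ (-q) := Real.rpow_nonneg hA.le _
  have hnorm : 0 ≤ fnorm A ^ p := Real.rpow_nonneg (fnorm_nonneg A) _
  have hnorm' : 0 ≤ fnorm A ^ (p - 2) := Real.rpow_nonneg (fnorm_nonneg A) _
  have hpow : fnorm A ^ (p - 2) * fnorm A ^ 2 = fnorm A ^ p := by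
    rw [← Real.rpow_natCast, ← Real.rpow_add_of_nonneg (fnorm_nonneg A) (by linarith) (by simp)]
    norm_num
  calc fnorm (Kstress p q α c A)
      ≤ α * fnorm A ^ (p - 2) * fnorm (A * Aᵀ) + c * A.det ^ (-q) * √d := by
        refine (fnorm_sub_le _ _).trans_eq ?_
        rw [fnorm_smul, fnorm_smul, fnorm_one, abs_of_nonneg (by positivity),
          abs_of_nonneg (by positivity)]
    _ ≤ α * fnorm A ^ (p - 2) * fnorm A ^ 2 + c * A.det ^ (-q) * √d := by
        gcongr
        exact fnorm_mul_transpose_self_le A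
    _ = p * (α / p * fnorm A ^ p) + q * √d * (c / q * A.det ^ (-q)) := by
        rw [mul_assoc α, hpow]
        field_simp
    _ ≤ max p (q * √d) * (α / p * fnorm A ^ p) +
          max p (q * √d) * (c / q * A.det ^ (-q)) := by
        gcongr
        · exact le_max_left _ _
        · exact le_max_right _ _
    _ ≤ max p (q * √d) * (1 + Wel p q α c A) := by
        rw [Wel, ← mul_add]
        exact mul_le_mul_of_nonneg_left (by linarith) (by positivity)
end
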